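/- Let M ∈ ℕ with M ≥ 1 and N ≥ 2. Then I_N ⊆ SI: every q ∈ I_N is strongly irreducible. -/

import Mathlib

open Classical

/-- The one-sided shift map on sequences. -/
def shift (x : ℕ → ℕ) : ℕ → ℕ := fun i => x (i + 1)

/-- Reflection of a sequence with respect to the alphabet `{0,…,M}`. -/
def reflSeq (M : ℕ) (x : ℕ → ℕ) : ℕ → ℕ := fun i => M - x i

/-- Strict lexicographic order on sequences. -/
def lexLT (x y : ℕ → ℕ) : Prop := ∃ n : ℕ, (∀ i < n, x i = y i) ∧ x n < y n

/-- Lexicographic order on sequences. -/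
def lexLE (x y : ℕ → ℕ) : Prop := x = y ∨ lexLT x y

/-- Strict lexicographic order on words (of the same length). -/
def wordLT (u v : List ℕ) : Prop :=
  ∃ n : ℕ, n < u.length ∧ (∀ i < n, u.getD i 0 = v.getD i 0) ∧ u.getD n 0 < v.getD n 0

/-- Lexicographic order on words (of the same length). -/
def wordLE (u v : List ℕ) : Prop := u = v ∨ wordLT u v

/-- Membership in the full shift over the alphabet `{0,…,M}`. -/
def memSigma (M : ℕ) (x : ℕ → ℕ) : Prop := ∀ i, x i ≤ M

/-- `a` is the quasi-greedy expansion of `1` in base `q` over the alphabet `{0,…,M}`: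
the lexicographically largest sequence with infinitely many nonzero entries satisfying
`∑ a_i q^{-i} = 1`. -/
def IsQuasiGreedy (M : ℕ) (q : ℝ) (a : ℕ → ℕ) : Prop :=
  memSigma M a ∧ (∀ n, ∃ m ≥ n, a m ≠ 0) ∧ (∑' i : ℕ, (a i : ℝ) / q ^ (i + 1)) = 1 ∧
    ∀ b : ℕ → ℕ, memSigma M b → (∀ n, ∃ m ≥ n, b m ≠ 0) →
      (∑' i : ℕ, (b i : ℝ) / q ^ (i + 1)) = 1 → lexLE b a

/-- The quasi-greedy expansion of `1` in base `q` (as a global function, via choice). -/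
noncomputable def qg (M : ℕ) (q : ℝ) : ℕ → ℕ :=
  if h : ∃ a, IsQuasiGreedy M q a then h.choose else fun _ => 0

/-- The set `V` of sequences `a` with `ā ≼ σⁿ(a) ≼ a` for all `n ≥ 0`. -/
def memV (M : ℕ) (a : ℕ → ℕ) : Prop :=
  memSigma M a ∧ ∀ n : ℕ, lexLE (reflSeq M a) (shift^[n] a) ∧ lexLE (shift^[n] a) a

/-- The set `V_L` of bases `q ∈ (1, M+1]` with `α(q) ∈ V`. -/
def memVL (M : ℕ) (q : ℝ) : Prop := 1 < q ∧ q ≤ M + 1 ∧ memV M (qg M q)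

/-- The symmetric `q`-shift `V_q`. -/
def Vq (M : ℕ) (q : ℝ) : Set (ℕ → ℕ) :=
  {x | memSigma M x ∧
    ∀ n : ℕ, lexLE (reflSeq M (qg M q)) (shift^[n] x) ∧ lexLE (shift^[n] x) (qg M q)}

/-- The word `w` occurs as a factor of the sequence `x`. -/
def IsFactorOf (w : List ℕ) (x : ℕ → ℕ) : Prop :=
  ∃ k : ℕ, ∀ i < w.length, x (k + i) = w.getD i 0

/-- Membership in the language of a subshift `X`. -/
def InLang (X : Set (ℕ → ℕ)) (w : List ℕ) : Prop := ∃ x ∈ X, IsFactorOf w x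

/-- The set of admissible words of length `k` of a subshift `X`. -/
def Bn (X : Set (ℕ → ℕ)) (k : ℕ) : Set (List ℕ) := {w | w.length = k ∧ InLang X w}

/-- The specification property. -/
def HasSpecification (X : Set (ℕ → ℕ)) : Prop :=
  ∃ S : ℕ, ∀ u v : List ℕ, InLang X u → InLang X v →
    ∃ w : List ℕ, w.length = S ∧ InLang X (u ++ w ++ v)

/-- Topological transitivity (language formulation). -/
def IsTransitive (X : Set (ℕ → ℕ)) : Prop :=
  ∀ u v : List ℕ, InLang X u → InLang X v → ∃ w : List ℕ, InLang X (u ++ w ++ v)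

/-- Topological mixing (language formulation). -/
def IsMixing (X : Set (ℕ → ℕ)) : Prop :=
  ∀ u v : List ℕ, InLang X u → InLang X v →
    ∃ N : ℕ, ∀ n ≥ N, ∃ w : List ℕ, w.length = n ∧ InLang X (u ++ w ++ v)

/-- Intrinsically synchronising word. -/
def IntrinsicallySynchronising (X : Set (ℕ → ℕ)) (w : List ℕ) : Prop :=
  ∀ u v : List ℕ, InLang X (u ++ w) → InLang X (w ++ v) → InLang X (u ++ w ++ v)

/-- Synchronised subshift: transitive with an intrinsically synchronising word. -/
def IsSynchronised (X : Set (ℕ → ℕ)) : Prop :=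
  IsTransitive X ∧ ∃ w : List ℕ, InLang X w ∧ IntrinsicallySynchronising X w

/-- Subshift of finite type over `{0,…,M}`: determined by a finite set of forbidden words. -/
def IsSFT (M : ℕ) (X : Set (ℕ → ℕ)) : Prop :=
  ∃ F : Finset (List ℕ), X = {x | memSigma M x ∧ ∀ w ∈ F, ¬ IsFactorOf w x}

/-- Coded system: the closure of an increasing union of transitive subshifts of finite type. -/
def IsCoded (M : ℕ) (X : Set (ℕ → ℕ)) : Prop :=
  ∃ Y : ℕ → Set (ℕ → ℕ), (∀ n, IsSFT M (Y n) ∧ IsTransitive (Y n)) ∧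
    (∀ n, Y n ⊆ Y (n + 1)) ∧ X = closure (⋃ n, Y n)

/-- `ω⁻`: decrease the last letter of a word by one. -/
def wMinus (w : List ℕ) : List ℕ := w.dropLast ++ [w.getLast! - 1]

/-- `ω⁺`: increase the last letter of a word by one. -/
def wPlus (w : List ℕ) : List ℕ := w.dropLast ++ [w.getLast! + 1]

/-- Reflection of a word. -/
def wRefl (M : ℕ) (w : List ℕ) : List ℕ := w.map (fun c => M - c)

/-- `ω^∞`: the periodic sequence repeating the word `w`. -/
def perSeq (w : List ℕ) : ℕ → ℕ := fun i => w.getD (i % w.length) 0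

/-- The sequence beginning with the word `u` followed by the periodic sequence `v^∞`. -/
def wordThenPer (u v : List ℕ) : ℕ → ℕ :=
  fun i => if i < u.length then u.getD i 0 else perSeq v (i - u.length)

/-- The prefix of length `n` of a sequence, as a word. -/
def prefixWord (a : ℕ → ℕ) (n : ℕ) : List ℕ := (List.range n).map a

/-- A sequence `a ∈ V` is irreducible if `a_1…a_j (\overline{a_1…a_j}⁺)^∞ ≺ a`
whenever `(a_1…a_j⁻)^∞ ∈ V`. -/
def IrreducibleSeq (M : ℕ) (a : ℕ → ℕ) : Prop :=
  ∀ j : ℕ, 1 ≤ j → memV M (perSeq (wMinus (prefixWord a j))) →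
    lexLT (wordThenPer (prefixWord a j) (wPlus (wRefl M (prefixWord a j)))) a

/-- The set `I` of irreducible bases. -/
def memI (M : ℕ) (q : ℝ) : Prop := memVL M q ∧ IrreducibleSeq M (qg M q)

/-- The set `U` of univoque bases. -/
def memU (M : ℕ) (q : ℝ) : Prop :=
  (1 < q ∧ q < M + 1 ∧ ∀ n : ℕ, 1 ≤ n →
      lexLT (reflSeq M (qg M q)) (shift^[n] (qg M q)) ∧
        lexLT (shift^[n] (qg M q)) (qg M q)) ∨ q = M + 1

/-- The set `U̅`: closure of the set of univoque bases. -/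
def memUbar (M : ℕ) (q : ℝ) : Prop :=
  1 < q ∧ q ≤ M + 1 ∧
    ∀ n : ℕ, lexLT (reflSeq M (qg M q)) (shift^[n] (qg M q)) ∧
      lexLE (shift^[n] (qg M q)) (qg M q)

/-- The indices `n_m` of the natural approximation from below (`approxIdx M q 0 = n_1`). -/
noncomputable def approxIdx (M : ℕ) (q : ℝ) : ℕ → ℕ
  | 0 => sInf {n : ℕ | 1 ≤ n ∧ memV M (perSeq (wMinus (prefixWord (qg M q) n)))}
  | m + 1 => sInf {n : ℕ | approxIdx M q m < n ∧ memV M (perSeq (wMinus (prefixWord (qg M q) n)))}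

/-- The base in `(1, M+1]` whose quasi-greedy expansion is `a` (via choice). -/
noncomputable def baseOf (M : ℕ) (a : ℕ → ℕ) : ℝ :=
  if h : ∃ q : ℝ, 1 < q ∧ q ≤ M + 1 ∧ qg M q = a then h.choose else 0

/-- The natural approximation from below of `q` (`approxBase M q 0 = q_1⁻`),
determined by `α(q_m⁻) = (α_1(q)…α_{n_m}(q)⁻)^∞`. -/
noncomputable def approxBase (M : ℕ) (q : ℝ) (m : ℕ) : ℝ :=
  baseOf M (perSeq (wMinus (prefixWord (qg M q) (approxIdx M q m))))

/-- Strongly irreducible base: `q ∈ I` and all but finitely many terms of the natural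
approximation from below lie in `I`. -/
def memSI (M : ℕ) (q : ℝ) : Prop :=
  memI M q ∧ ∃ N : ℕ, ∀ m ≥ N, memI M (approxBase M q m)

/-- Weakly irreducible base: `q ∈ I` but infinitely many terms of the natural
approximation from below are not in `I`. -/
def memWI (M : ℕ) (q : ℝ) : Prop :=
  memI M q ∧ ∀ N : ℕ, ∃ m ≥ N, ¬ memI M (approxBase M q m)

/-- The generalised golden ratio `q_G(M)`. -/
noncomputable def qG (M : ℕ) : ℝ :=
  if M % 2 = 0 then ((M / 2 : ℕ) : ℝ) + 1
  else (((M / 2 : ℕ) : ℝ) + 1 +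
    Real.sqrt (((M / 2 : ℕ) : ℝ) ^ 2 + 6 * ((M / 2 : ℕ) : ℝ) + 5)) / 2

/-- The metric on `Σ_M`: `d(x,y) = 2^{-j}` where `j` is the first (1-indexed) place
where `x` and `y` differ. -/
noncomputable def seqDist (x y : ℕ → ℕ) : ℝ :=
  if x = y then 0 else (1 / 2 : ℝ) ^ (sInf {i : ℕ | x i ≠ y i} + 1)

/-- Fundamental word (Allaart). -/
def IsFundamentalWord (M : ℕ) (w : List ℕ) : Prop :=
  2 < w.length ∧ ∀ i : ℕ, 1 ≤ i → i ≤ w.length - 1 →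
    wordLE (wRefl M (w.take (w.length - i))) (w.drop i) ∧
      wordLT (w.drop i) (w.take (w.length - i))

/-- The set `I_N`. -/
def memIN (M N : ℕ) (q : ℝ) : Prop :=
  memVL M q ∧
    prefixWord (qg M q) (2 * N) = List.replicate (2 * N - 1) M ++ [0] ∧
    ∀ r : ℕ, 2 ≤ r →
      wordLT (List.replicate N 0) ((List.range N).map (fun i => qg M q (r * N + i))) ∧
      wordLT ((List.range N).map (fun i => qg M q (r * N + i))) (List.replicate N M)

/-- The (forward) orbit of a sequence under the shift. -/
def orbit (a : ℕ → ℕ) : Set (ℕ → ℕ) := {y | ∃ n : ℕ, y = shift^[n] a}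


theorem lexLT_of_le {u v : ℕ → ℕ} {k : ℕ} (h : ∀ i < k, u i ≤ v i) (hk : u k < v k) :
    lexLT u v := by
  have hex : ∃ n, u n < v n := ⟨k, hk⟩
  refine ⟨Nat.find hex, fun i hi => ?_, Nat.find_spec hex⟩
  have h1 := Nat.find_min hex hi
  have h2 : Nat.find hex ≤ k := Nat.find_min' hex hk
  have h3 := h i (by omega)
  omega

theorem lexLT_asymm {u v : ℕ → ℕ} (h₁ : lexLT u v) (h₂ : lexLT v u) : False := by
  obtain ⟨n, hn, hn'⟩ := h₁
  obtain ⟨m, hm, hm'⟩ := h₂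
  rcases lt_trichotomy n m with h | h | h
  · have := hm n h
    omega
  · subst h
    omega
  · have := hn m h
    omega

theorem lexLE_antisymm {u v : ℕ → ℕ} (h₁ : lexLE u v) (h₂ : lexLE v u) : u = v := by
  rcases h₁ with h₁ | h₁
  · exact h₁
  · rcases h₂ with h₂ | h₂
    · exact h₂.symm
    · exact (lexLT_asymm h₁ h₂).elim

theorem lexLE_or_lexLT (u v : ℕ → ℕ) : lexLE u v ∨ lexLT v u := by
  by_cases h : u = v
  · exact Or.inl (Or.inl h)
  · have hex : ∃ n, u n ≠ v n := by
      by_contra hcon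
      push Not at hcon
      exact h (funext hcon)
    have hmin : ∀ i < Nat.find hex, u i = v i := fun i hi => by
      simpa using Nat.find_min hex hi
    rcases lt_or_gt_of_ne (Nat.find_spec hex) with h' | h'
    · exact Or.inl (Or.inr ⟨_, hmin, h'⟩)
    · exact Or.inr ⟨_, fun i hi => (hmin i hi).symm, h'⟩

theorem shift_iterate_apply (x : ℕ → ℕ) (n i : ℕ) : shift^[n] x i = x (n + i) := by
  induction n generalizing i with
  | zero => simp
  | succ n ih =>
    rw [Function.iterate_succ_apply', shift, ih]
    congr 1
    omega

theorem prefixWord_length (x : ℕ → ℕ) (j : ℕ) : (prefixWord x j).length = j := by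
  simp [prefixWord]

theorem prefixWord_getD (x : ℕ → ℕ) {j i : ℕ} (h : i < j) : (prefixWord x j).getD i 0 = x i := by
  simp [prefixWord, h]

theorem prefixWord_succ (x : ℕ → ℕ) (k : ℕ) :
    prefixWord x (k + 1) = prefixWord x k ++ [x k] := by
  simp [prefixWord, List.range_succ]

theorem perSeq_wMinus_prefixWord (x : ℕ → ℕ) {n : ℕ} (hn : 1 ≤ n) (i : ℕ) :
    perSeq (wMinus (prefixWord x n)) i =
      if i % n = n - 1 then x (n - 1) - 1 else x (i % n) := by
  obtain ⟨k, rfl⟩ : ∃ k, n = k + 1 := ⟨n - 1, by omega⟩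
  have hlt : i % (k + 1) < k + 1 := Nat.mod_lt _ (by omega)
  have hw : wMinus (prefixWord x (k + 1)) = prefixWord x k ++ [x k - 1] := by
    simp [wMinus, prefixWord_succ]
  rw [hw, perSeq]
  simp only [List.length_append, prefixWord_length, List.length_singleton, Nat.add_sub_cancel]
  split_ifs with h
  · rw [h, List.getD_append_right _ _ _ _ (by simp [prefixWord_length])]
    simp [prefixWord_length]
  · rw [List.getD_append _ _ _ _ (by rw [prefixWord_length]; omega),
      prefixWord_getD _ (by omega)]

theorem wordThenPer_apply_of_lt (x : ℕ → ℕ) (v : List ℕ) {j i : ℕ} (h : i < j) :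
    wordThenPer (prefixWord x j) v i = x i := by
  rw [wordThenPer, prefixWord_length, if_pos h, prefixWord_getD x h]

theorem wordThenPer_wPlus_wRefl (M : ℕ) (x : ℕ → ℕ) {j : ℕ} (hj : 1 ≤ j) (i : ℕ) :
    wordThenPer (prefixWord x j) (wPlus (wRefl M (prefixWord x j))) (j + i) =
      if i % j = j - 1 then M - x (j - 1) + 1 else M - x (i % j) := by
  rw [wordThenPer, prefixWord_length, if_neg (by omega), Nat.add_sub_cancel_left]
  obtain ⟨k, rfl⟩ : ∃ k, j = k + 1 := ⟨j - 1, by omega⟩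
  have hlt : i % (k + 1) < k + 1 := Nat.mod_lt _ (by omega)
  have hw : wPlus (wRefl M (prefixWord x (k + 1))) =
      prefixWord (fun i => M - x i) k ++ [M - x k + 1] := by
    have hr : wRefl M (prefixWord x (k + 1)) = prefixWord (fun i => M - x i) (k + 1) := by
      simp [wRefl, prefixWord]
    rw [hr]
    simp [wPlus, prefixWord_succ]
  rw [hw, perSeq]
  simp only [List.length_append, prefixWord_length, List.length_singleton, Nat.add_sub_cancel]
  split_ifs with h
  · rw [h, List.getD_append_right _ _ _ _ (by simp [prefixWord_length])]
    simp [prefixWord_length]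
  · rw [List.getD_append _ _ _ _ (by rw [prefixWord_length]; omega),
      prefixWord_getD _ (by omega)]

/-- A sequence starting with `M^{2N-1} 0` in which, past the first `2N` digits, each factor
`0^{2N-1}` is followed by `M^{N+1}` is irreducible. -/
theorem irreducibleSeq_of_zero_runs {M N : ℕ} (hM : 1 ≤ M) (hN : 2 ≤ N) {x : ℕ → ℕ}
    (hpre : ∀ i < 2 * N - 1, x i = M) (h0 : x (2 * N - 1) = 0)
    (hb₂ : ∃ i, 2 * N ≤ i ∧ i < 3 * N ∧ 0 < x i)
    (hb₃ : ∃ i, 3 * N ≤ i ∧ i < 4 * N ∧ 0 < x i)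
    (hrun : ∀ j, 2 * N ≤ j → (∀ i < 2 * N - 1, x (j + i) = 0) →
      3 * N < j ∧ ∀ i < N + 1, x (j + (2 * N - 1) + i) = M) :
    IrreducibleSeq M x := by
  intro j hj hV
  have hU₁ : ∀ i < j, wordThenPer (prefixWord x j) (wPlus (wRefl M (prefixWord x j))) i = x i :=
    fun i hi => wordThenPer_apply_of_lt x _ hi
  have hU₂ := wordThenPer_wPlus_wRefl M x hj
  set U := wordThenPer (prefixWord x j) (wPlus (wRefl M (prefixWord x j))) with hU
  rcases lt_trichotomy j (2 * N - 1) with hlt | heq | hgt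
  · refine ⟨j, hU₁, ?_⟩
    have h := hU₂ 0
    rw [Nat.add_zero, Nat.zero_mod, hpre 0 (by omega), hpre (j - 1) (by omega)] at h
    rw [h, hpre j hlt]
    split_ifs with hj1
    · have hj1 : j = 1 := by omega
      subst hj1
      by_contra hcon
      have hM1 : M = 1 := by omega
      have hz : ∀ i, perSeq (wMinus (prefixWord x 1)) i = 0 := by
        intro i
        rw [perSeq_wMinus_prefixWord x le_rfl]
        simp [Nat.mod_one, hpre 0 (by omega), hM1]
      have := (hV.2 0).1
      rcases this with h' | ⟨n, -, h'⟩
      · have h'' := congrFun h' 0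
        simp [reflSeq, hz, hM1] at h''
      · simp [reflSeq, hz, hM1] at h'
    · omega
  · obtain ⟨i₂, hi₂, hi₂', hx₂⟩ := hb₂
    obtain ⟨i₃, hi₃, hi₃', hx₃⟩ := hb₃
    have hUz : ∀ i < 2 * N - 2, U (j + i) = 0 := by
      intro i hi
      rw [hU₂, Nat.mod_eq_of_lt (by omega), if_neg (by omega), hpre i (by omega)]
      omega
    by_cases hc : i₂ < 4 * N - 3
    · refine lexLT_of_le (k := i₂) (fun i hi => ?_) ?_
      · by_cases hij : i < j
        · exact (hU₁ i hij).le
        · have := hUz (i - j) (by omega)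
          rw [show j + (i - j) = i by omega] at this
          omega
      · have := hUz (i₂ - j) (by omega)
        rw [show j + (i₂ - j) = i₂ by omega] at this
        omega
    · have hN2 : N = 2 := by omega
      subst hN2
      have hi₂5 : i₂ = 5 := by omega
      subst hi₂5
      have hj3 : j = 3 := by omega
      have h3 := hUz 0 (by omega)
      have h4 := hUz 1 (by omega)
      have h5 := hU₂ 2
      have h6 := hU₂ 3
      have h7 := hU₂ 4
      rw [hj3] at h3 h4 h5 h6 h7
      simp only [hpre 0 (by omega), hpre 1 (by omega), hpre 2 (by omega)] at h5 h6 h7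
      norm_num [hpre 0 (by omega), hpre 1 (by omega)] at h3 h4 h5 h6 h7
      refine lexLT_of_le (k := i₃) (fun i hi => ?_) ?_
      · by_cases hij : i < j
        · exact (hU₁ i hij).le
        · have : i = 3 ∨ i = 4 ∨ i = 5 ∨ i = 6 := by omega
          rcases this with rfl | rfl | rfl | rfl <;> omega
      · have : i₃ = 6 ∨ i₃ = 7 := by omega
        rcases this with rfl | rfl <;> omega
  · have hUz : ∀ i < 2 * N - 1, U (j + i) = 0 := by
      intro i hi
      rw [hU₂, Nat.mod_eq_of_lt (by omega), if_neg (by omega), hpre i (by omega)]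
      omega
    by_cases hz : ∀ i < 2 * N - 1, x (j + i) = 0
    · obtain ⟨hj3, hfol⟩ := hrun j (by omega) hz
      obtain ⟨i₂, hi₂, hi₂', hx₂⟩ := hb₂
      have hxM : ∀ i, 2 * N - 1 ≤ i → i < 3 * N → x (j + i) = M := by
        intro i hi hi'
        have := hfol (i - (2 * N - 1)) (by omega)
        rwa [show j + (2 * N - 1) + (i - (2 * N - 1)) = j + i by omega] at this
      have hUr : ∀ i < 3 * N, U (j + i) = M - x i := by
        intro i hi
        rw [hU₂, Nat.mod_eq_of_lt (by omega), if_neg (by omega)]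
      refine lexLT_of_le (k := j + i₂) (fun i hi => ?_) ?_
      · by_cases hij : i < j
        · exact (hU₁ i hij).le
        · obtain ⟨k, rfl⟩ : ∃ k, i = j + k := ⟨i - j, by omega⟩
          by_cases hk : k < 2 * N - 1
          · rw [hUz k hk]
            omega
          · rw [hUr k (by omega), hxM k (by omega) (by omega)]
            omega
      · rw [hUr _ hi₂', hxM _ (by omega) hi₂']
        omega
    · push Not at hz
      obtain ⟨i₀, hi₀, hx₀⟩ := hz
      refine lexLT_of_le (k := j + i₀) (fun i hi => ?_) ?_
      · by_cases hij : i < j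
        · exact (hU₁ i hij).le
        · have := hUz (i - j) (by omega)
          rw [show j + (i - j) = i by omega] at this
          omega
      · rw [hUz _ hi₀]
        omega

/-- Among `2N-1` consecutive digits past the first `2N` there is a complete aligned block of
length `N`. -/
theorem exists_pos_and_exists_lt_of_blocks {M N : ℕ} (hN : 2 ≤ N) {x : ℕ → ℕ}
    (hblock : ∀ r : ℕ, 2 ≤ r →
      (∃ i < N, 0 < x (r * N + i)) ∧ ∃ i < N, x (r * N + i) < M)
    {j : ℕ} (hj : 2 * N ≤ j) :
    (∃ i < 2 * N - 1, 0 < x (j + i)) ∧ ∃ i < 2 * N - 1, x (j + i) < M := by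
  obtain ⟨r, hr, hr₁, hr₂⟩ : ∃ r, 2 ≤ r ∧ j ≤ r * N ∧ r * N ≤ j + N - 1 := by
    refine ⟨(j + N - 1) / N, ?_, ?_, Nat.div_mul_le_self _ _⟩
    · rw [Nat.le_div_iff_mul_le (by omega)]
      omega
    · have := Nat.lt_div_mul_add (a := j + N - 1) (b := N) (by omega)
      omega
  obtain ⟨⟨i, hi, hx⟩, ⟨k, hk, hx'⟩⟩ := hblock r hr
  refine ⟨⟨r * N + i - j, by omega, ?_⟩, ⟨r * N + k - j, by omega, ?_⟩⟩
  · rwa [show j + (r * N + i - j) = r * N + i by omega]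
  · rwa [show j + (r * N + k - j) = r * N + k by omega]

theorem eq_tail_of_zero_run_perSeq {M N n : ℕ} (hM : 1 ≤ M) (hN : 2 ≤ N) (hn : 6 * N ≤ n)
    {x : ℕ → ℕ} (hpre : ∀ i < 2 * N - 1, x i = M)
    (hblock : ∀ r : ℕ, 2 ≤ r →
      (∃ i < N, 0 < x (r * N + i)) ∧ ∃ i < N, x (r * N + i) < M)
    {p : ℕ} (hz : ∀ i < 2 * N - 1, perSeq (wMinus (prefixWord x n)) (p + i) = 0) :
    p % n + (2 * N - 1) = n := by
  have ha := perSeq_wMinus_prefixWord x (n := n) (by omega)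
  have hr : p % n < n := Nat.mod_lt _ (by omega)
  have hmod : ∀ i, p % n + i < n → (p + i) % n = p % n + i := by
    intro i hi
    rw [Nat.add_mod, Nat.mod_eq_of_lt (a := i) (by omega), Nat.mod_eq_of_lt hi]
  by_contra hne
  by_cases h1 : p % n < 2 * N - 1
  · have := hz 0 (by omega)
    rw [ha, hmod 0 (by omega), if_neg (by omega), hpre _ (by omega)] at this
    omega
  by_cases h2 : p % n = 2 * N - 1
  · obtain ⟨i, hi, hx⟩ := (hblock 2 le_rfl).1
    have := hz (i + 1) (by omega)
    rw [ha, hmod _ (by omega), if_neg (by omega), h2,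
      show 2 * N - 1 + (i + 1) = 2 * N + i by omega] at this
    omega
  by_cases h3 : p % n + (2 * N - 1) < n
  · obtain ⟨i, hi, hx⟩ := (exists_pos_and_exists_lt_of_blocks hN hblock
      (j := p % n) (by omega)).1
    have := hz i hi
    rw [ha, hmod _ (by omega), if_neg (by omega)] at this
    omega
  · have := hz (n - p % n) (by omega)
    have hm : (p + (n - p % n)) % n = 0 := by
      rw [← Nat.mod_add_mod, show p % n + (n - p % n) = n by omega, Nat.mod_self]
    rw [ha, hm, if_neg (by omega), hpre 0 (by omega)] at this
    omega

theorem perSeq_eq_of_zero_run {M N n : ℕ} (hM : 1 ≤ M) (hN : 2 ≤ N) (hn : 6 * N ≤ n)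
    {x : ℕ → ℕ} (hpre : ∀ i < 2 * N - 1, x i = M)
    (hblock : ∀ r : ℕ, 2 ≤ r →
      (∃ i < N, 0 < x (r * N + i)) ∧ ∃ i < N, x (r * N + i) < M)
    {p : ℕ} (hz : ∀ i < 2 * N - 1, perSeq (wMinus (prefixWord x n)) (p + i) = 0)
    {i : ℕ} (hi : i < N + 1) :
    perSeq (wMinus (prefixWord x n)) (p + (2 * N - 1) + i) = M := by
  have h := eq_tail_of_zero_run_perSeq hM hN hn hpre hblock hz
  have hm : (p + (2 * N - 1) + i) % n = i := by
    have h1 : p + (2 * N - 1) + i = i + n * (p / n + 1) := by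
      have := Nat.div_add_mod p n
      rw [Nat.mul_add, Nat.mul_one]
      omega
    rw [h1, Nat.add_mul_mod_self_left, Nat.mod_eq_of_lt (by omega)]
  rw [perSeq_wMinus_prefixWord x (by omega), hm, if_neg (by omega), hpre i (by omega)]

theorem irreducibleSeq_perSeq {M N n : ℕ} (hM : 1 ≤ M) (hN : 2 ≤ N) (hn : 6 * N ≤ n)
    {x : ℕ → ℕ} (hpre : ∀ i < 2 * N - 1, x i = M) (h0 : x (2 * N - 1) = 0)
    (hblock : ∀ r : ℕ, 2 ≤ r →
      (∃ i < N, 0 < x (r * N + i)) ∧ ∃ i < N, x (r * N + i) < M) :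
    IrreducibleSeq M (perSeq (wMinus (prefixWord x n))) := by
  have ha : ∀ i < n - 1, perSeq (wMinus (prefixWord x n)) i = x i := by
    intro i hi
    rw [perSeq_wMinus_prefixWord x (by omega), Nat.mod_eq_of_lt (by omega), if_neg (by omega)]
  refine irreducibleSeq_of_zero_runs hM hN (fun i hi => ?_) ?_ ?_ ?_ (fun j hj hz => ?_)
  · rw [ha i (by omega), hpre i hi]
  · rw [ha _ (by omega), h0]
  · obtain ⟨i, hi, hx⟩ := (hblock 2 (by omega)).1
    exact ⟨2 * N + i, by omega, by omega, by rwa [ha _ (by omega)]⟩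
  · obtain ⟨i, hi, hx⟩ := (hblock 3 (by omega)).1
    exact ⟨3 * N + i, by omega, by omega, by rwa [ha _ (by omega)]⟩
  · have h := eq_tail_of_zero_run_perSeq hM hN hn hpre hblock hz
    have := Nat.mod_le j n
    exact ⟨by omega, fun i hi => perSeq_eq_of_zero_run hM hN hn hpre hblock hz hi⟩

theorem memV_perSeq {M N n : ℕ} (hM : 1 ≤ M) (hN : 2 ≤ N) (hn : 6 * N ≤ n)
    {x : ℕ → ℕ} (hx : memSigma M x) (hpre : ∀ i < 2 * N - 1, x i = M) (h0 : x (2 * N - 1) = 0)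
    (hblock : ∀ r : ℕ, 2 ≤ r →
      (∃ i < N, 0 < x (r * N + i)) ∧ ∃ i < N, x (r * N + i) < M)
    (hlast : 0 < x (n - 1)) :
    memV M (perSeq (wMinus (prefixWord x n))) := by
  have ha := perSeq_wMinus_prefixWord x (n := n) (by omega)
  have hrun := fun p => perSeq_eq_of_zero_run (p := p) hM hN hn hpre hblock
  have ha' : ∀ i < n - 1, perSeq (wMinus (prefixWord x n)) i = x i := by
    intro i hi
    rw [ha, Nat.mod_eq_of_lt (by omega), if_neg (by omega)]
  set a := perSeq (wMinus (prefixWord x n)) with hadef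
  have haM : memSigma M a := by
    intro i
    have h1 := hx (n - 1)
    have h2 := hx (i % n)
    rw [ha]
    split_ifs <;> omega
  refine ⟨haM, fun p => ⟨?_, ?_⟩⟩
  · right
    by_cases hz : ∀ i < 2 * N - 1, a (p + i) = 0
    · obtain ⟨i₀, hi₀, hx₀⟩ := (hblock 2 le_rfl).1
      have hfol : ∀ i, 2 * N - 1 ≤ i → i < 3 * N → a (p + i) = M := by
        intro i hi hi'
        have := hrun p hz (i := i - (2 * N - 1)) (by omega)
        rwa [show p + (2 * N - 1) + (i - (2 * N - 1)) = p + i by omega] at this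
      refine lexLT_of_le (k := 2 * N + i₀) (fun i hi => ?_) ?_
      · rw [shift_iterate_apply, reflSeq]
        by_cases hk : i < 2 * N - 1
        · rw [ha' i (by omega), hpre i hk]
          omega
        · rw [hfol i (by omega) (by omega)]
          omega
      · rw [shift_iterate_apply, reflSeq, hfol _ (by omega) (by omega), ha' _ (by omega)]
        omega
    · push Not at hz
      obtain ⟨i₀, hi₀, hx₀⟩ := hz
      have hr : ∀ i < 2 * N - 1, reflSeq M a i = 0 := by
        intro i hi
        rw [reflSeq, ha' i (by omega), hpre i hi]
        omega
      refine lexLT_of_le (k := i₀) (fun i hi => ?_) ?_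
      · rw [hr i (by omega)]
        omega
      · rw [hr i₀ hi₀, shift_iterate_apply]
        omega
  · by_cases hp : p % n = 0
    · left
      funext i
      rw [shift_iterate_apply, ha, ha, Nat.add_mod, hp, Nat.zero_add, Nat.mod_mod]
    · right
      have hr : p % n < n := Nat.mod_lt _ (by omega)
      have hmod : ∀ i, p % n + i < n → (p + i) % n = p % n + i := by
        intro i hi
        rw [Nat.add_mod, Nat.mod_eq_of_lt (a := i) (by omega), Nat.mod_eq_of_lt hi]
      obtain ⟨i₀, hi₀, hlt⟩ : ∃ i < 2 * N - 1, a (p + i) < M := by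
        by_cases h1 : p % n ≤ 2 * N - 1
        · refine ⟨2 * N - 1 - p % n, by omega, ?_⟩
          rw [ha, hmod _ (by omega), show p % n + (2 * N - 1 - p % n) = 2 * N - 1 by omega,
            if_neg (by omega), h0]
          omega
        · by_cases h2 : p % n + (2 * N - 1) < n
          · obtain ⟨i, hi, hlt⟩ := (exists_pos_and_exists_lt_of_blocks hN hblock
              (j := p % n) (by omega)).2
            refine ⟨i, hi, ?_⟩
            rw [ha, hmod _ (by omega), if_neg (by omega)]
            exact hlt
          · refine ⟨n - 1 - p % n, by omega, ?_⟩
            have := hx (n - 1)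
            rw [ha, hmod _ (by omega), if_pos (by omega)]
            omega
      refine lexLT_of_le (k := i₀) (fun i hi => ?_) ?_
      · rw [ha' i (by omega), hpre i (by omega)]
        exact (shift_iterate_apply a p i).symm ▸ haM _
      · rw [shift_iterate_apply, ha' i₀ (by omega), hpre i₀ hi₀]
        exact hlt

theorem summable_digits {M : ℕ} {q : ℝ} (hq : 1 < q) {b : ℕ → ℕ} (hb : memSigma M b) :
    Summable fun i : ℕ => (b i : ℝ) / q ^ (i + 1) := by
  have hg : Summable fun i : ℕ => (M : ℝ) * (1 / q) ^ (i + 1) :=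
    (((summable_geometric_of_lt_one (by positivity)
      (by rw [div_lt_one (by linarith)]; exact hq)).comp_injective
        (add_left_injective 1)).mul_left (M : ℝ))
  refine Summable.of_nonneg_of_le (fun i => by positivity) (fun i => ?_) hg
  rw [div_eq_mul_one_div, one_div_pow]
  have : (b i : ℝ) ≤ M := by exact_mod_cast hb i
  gcongr

theorem tsum_digits_split {M : ℕ} {q : ℝ} (hq : 1 < q) {b : ℕ → ℕ} (hb : memSigma M b) (m : ℕ) :
    ∑' i : ℕ, (b i : ℝ) / q ^ (i + 1) =
      ∑ i ∈ Finset.range m, (b i : ℝ) / q ^ (i + 1) + (b m : ℝ) / q ^ (m + 1) +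
        (∑' i : ℕ, ((shift^[m + 1] b) i : ℝ) / q ^ (i + 1)) / q ^ (m + 1) := by
  rw [← (summable_digits hq hb).sum_add_tsum_nat_add (m + 1), Finset.sum_range_succ,
    ← tsum_div_const]
  congr 1
  refine tsum_congr fun i => ?_
  rw [shift_iterate_apply, div_div, ← pow_add]
  congr 2
  · congr 1
    omega
  · omega

theorem memSigma_shift {M : ℕ} {b : ℕ → ℕ} (hb : memSigma M b) (k : ℕ) :
    memSigma M (shift^[k] b) := fun i => by
  rw [shift_iterate_apply]
  exact hb _

/-- If every shift of `a` is lexicographically at most `a` and `a` has value `1` in base `q`,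
then every shift of `a` has value at most `1`. -/
theorem tsum_shift_le_one {M : ℕ} {q : ℝ} (hq : 1 < q) {a : ℕ → ℕ} (ha : memSigma M a)
    (hle : ∀ n, lexLE (shift^[n] a) a) (hsum : ∑' i : ℕ, (a i : ℝ) / q ^ (i + 1) = 1) (k : ℕ) :
    ∑' i : ℕ, ((shift^[k] a) i : ℝ) / q ^ (i + 1) ≤ 1 := by
  set v : ℕ → ℝ := fun k => ∑' i : ℕ, ((shift^[k] a) i : ℝ) / q ^ (i + 1) with hv
  have hq0 : 0 < q := by linarith
  have hv0 : ∀ k, 0 ≤ v k := fun k => tsum_nonneg fun i => by positivity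
  obtain ⟨C, hC0, hC⟩ : ∃ C : ℝ, 0 ≤ C ∧ ∀ k, v k ≤ C := by
    refine ⟨∑' i : ℕ, (((fun _ => M : ℕ → ℕ) i : ℕ) : ℝ) / q ^ (i + 1),
      tsum_nonneg fun i => by positivity, fun k => ?_⟩
    refine (summable_digits hq (memSigma_shift ha k)).tsum_le_tsum (fun i => ?_)
      (summable_digits (M := M) hq (fun _ => le_rfl))
    have : ((shift^[k] a) i : ℝ) ≤ M := by exact_mod_cast memSigma_shift ha k i
    gcongr
  have hstep : ∀ t k, v k ≤ 1 + C * (1 / q) ^ t := by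
    intro t
    induction t with
    | zero =>
      intro k
      have := hC k
      simp only [pow_zero, mul_one]
      linarith
    | succ t ih =>
      intro k
      have hpos : 0 ≤ C * (1 / q) ^ (t + 1) := by positivity
      rcases hle k with h | ⟨m, hm, hlt⟩
      · have : v k = 1 := by rw [hv]; simp only [h, hsum]
        linarith
      · have h1 := tsum_digits_split hq (memSigma_shift ha k) m
        have h2 := tsum_digits_split hq ha m
        rw [hsum] at h2
        have h3 : ∑ i ∈ Finset.range m, ((shift^[k] a) i : ℝ) / q ^ (i + 1) =
            ∑ i ∈ Finset.range m, (a i : ℝ) / q ^ (i + 1) :=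
          Finset.sum_congr rfl fun i hi => by rw [hm i (Finset.mem_range.1 hi)]
        rw [← Function.iterate_add_apply] at h1
        have h4 : ((shift^[k] a) m : ℝ) / q ^ (m + 1) ≤
            (a m : ℝ) / q ^ (m + 1) - 1 / q ^ (m + 1) := by
          rw [← sub_div]
          have : ((shift^[k] a) m : ℝ) + 1 ≤ a m := by exact_mod_cast hlt
          gcongr
          linarith
        have h5 : v (m + 1 + k) / q ^ (m + 1) ≤ (1 + C * (1 / q) ^ t) / q ^ (m + 1) := by
          gcongr
          exact ih _
        have h6 : 0 ≤ v (m + 1) / q ^ (m + 1) := div_nonneg (hv0 _) (by positivity)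
        have h7 : C * (1 / q) ^ t / q ^ (m + 1) ≤ C * (1 / q) ^ (t + 1) := by
          rw [pow_succ (1 / q), ← mul_assoc, mul_one_div]
          have : q ≤ q ^ (m + 1) := by
            simpa using pow_le_pow_right₀ hq.le (show 1 ≤ m + 1 by omega)
          gcongr
        rw [add_div] at h5
        simp only [hv] at h5 h6 ⊢
        linarith
  have hlim : Filter.Tendsto (fun t : ℕ => 1 + C * (1 / q) ^ t) Filter.atTop (nhds (1 + C * 0)) :=
    ((tendsto_pow_atTop_nhds_zero_of_lt_one (by positivity)
      (by rw [div_lt_one hq0]; exact hq)).const_mul C).const_add 1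
  have := ge_of_tendsto' hlim fun t => hstep t k
  simpa using this

theorem isQuasiGreedy_of_shift_le {M : ℕ} {q : ℝ} (hq : 1 < q) {a : ℕ → ℕ} (ha : memSigma M a)
    (hinf : ∀ n, ∃ m ≥ n, a m ≠ 0) (hle : ∀ n, lexLE (shift^[n] a) a)
    (hsum : ∑' i : ℕ, (a i : ℝ) / q ^ (i + 1) = 1) : IsQuasiGreedy M q a := by
  refine ⟨ha, hinf, hsum, fun b hb hbinf hbsum => ?_⟩
  rcases lexLE_or_lexLT b a with h | ⟨m, hm, hlt⟩
  · exact h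
  exfalso
  have hq0 : 0 < q := by linarith
  have h1 := tsum_digits_split hq hb m
  have h2 := tsum_digits_split hq ha m
  rw [hsum] at h2
  rw [hbsum] at h1
  have h3 : ∑ i ∈ Finset.range m, (a i : ℝ) / q ^ (i + 1) =
      ∑ i ∈ Finset.range m, (b i : ℝ) / q ^ (i + 1) :=
    Finset.sum_congr rfl fun i hi => by rw [hm i (Finset.mem_range.1 hi)]
  have h4 : (a m : ℝ) / q ^ (m + 1) + 1 / q ^ (m + 1) ≤ (b m : ℝ) / q ^ (m + 1) := by
    rw [← add_div]
    have : (a m : ℝ) + 1 ≤ b m := by exact_mod_cast hlt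
    gcongr
  have h5 : (∑' i : ℕ, ((shift^[m + 1] a) i : ℝ) / q ^ (i + 1)) / q ^ (m + 1) ≤
      1 / q ^ (m + 1) := by
    gcongr
    exact tsum_shift_le_one hq ha hle hsum _
  have h6 : 0 < (∑' i : ℕ, ((shift^[m + 1] b) i : ℝ) / q ^ (i + 1)) / q ^ (m + 1) := by
    obtain ⟨l, hl, hbl⟩ := hbinf (m + 1)
    refine div_pos ((summable_digits hq (memSigma_shift hb _)).tsum_pos
      (fun i => by positivity) (l - (m + 1)) ?_) (by positivity)
    rw [shift_iterate_apply, show m + 1 + (l - (m + 1)) = l by omega]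
    have : 0 < b l := by omega
    positivity
  linarith

theorem qg_eq_of_isQuasiGreedy {M : ℕ} {q : ℝ} {a : ℕ → ℕ} (h : IsQuasiGreedy M q a) :
    qg M q = a := by
  have hex : ∃ a, IsQuasiGreedy M q a := ⟨a, h⟩
  have hs := hex.choose_spec
  rw [qg, dif_pos hex]
  exact lexLE_antisymm (h.2.2.2 _ hs.1 hs.2.1 hs.2.2.1) (hs.2.2.2 _ h.1 h.2.1 h.2.2.1)

/-- A sequence starting with `M M` takes the value `1` in some base. -/
theorem exists_base_tsum_eq_one {M : ℕ} (hM : 1 ≤ M) {a : ℕ → ℕ} (ha : memSigma M a)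
    (h0 : a 0 = M) (h1 : a 1 = M) :
    ∃ q : ℝ, 1 < q ∧ q ≤ M + 1 ∧ ∑' i : ℕ, (a i : ℝ) / q ^ (i + 1) = 1 := by
  have hM' : (1 : ℝ) ≤ M := by exact_mod_cast hM
  have hcont : ContinuousOn (fun q : ℝ => ∑' i : ℕ, (a i : ℝ) / q ^ (i + 1))
      (Set.Icc (3 / 2) (M + 1)) := by
    refine continuousOn_tsum (u := fun i => (M : ℝ) / (3 / 2 : ℝ) ^ (i + 1)) (fun i => ?_)
      (summable_digits (M := M) (b := fun _ => M) (by norm_num) (fun _ => le_rfl))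
      (fun i q hq => ?_)
    · refine continuousOn_const.div (continuousOn_id.pow _) fun q hq => ?_
      have : (0 : ℝ) < q := by linarith [hq.1]
      simpa using this.ne'
    · have hq0 : (0 : ℝ) < q := by linarith [hq.1]
      rw [Real.norm_of_nonneg (by positivity)]
      have : (a i : ℝ) ≤ M := by exact_mod_cast ha i
      have := hq.1
      gcongr
  have hlow : 1 ≤ ∑' i : ℕ, (a i : ℝ) / (3 / 2 : ℝ) ^ (i + 1) := by
    have := (summable_digits (q := 3 / 2) (by norm_num) ha).sum_le_tsum (Finset.range 2)
      (fun i _ => by positivity)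
    refine le_trans ?_ this
    rw [Finset.sum_range_succ, Finset.sum_range_one, h0, h1]
    norm_num
    linarith
  have hhigh : ∑' i : ℕ, (a i : ℝ) / ((M : ℝ) + 1) ^ (i + 1) ≤ 1 := by
    have hq : (1 : ℝ) < M + 1 := by linarith
    have hlt : 1 / ((M : ℝ) + 1) < 1 := by rw [div_lt_one (by linarith)]; exact hq
    have hgeo := ((hasSum_geometric_of_lt_one (by positivity) hlt).mul_left
      ((M : ℝ) / (M + 1)))
    have hval : (M : ℝ) / (M + 1) * (1 - 1 / ((M : ℝ) + 1))⁻¹ = 1 := by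
      have : (M : ℝ) ≠ 0 := by positivity
      have h' : (1 : ℝ) - 1 / ((M : ℝ) + 1) = M / (M + 1) := by
        field_simp
        ring
      rw [h', mul_inv_cancel₀ (by positivity)]
    rw [hval] at hgeo
    refine ((summable_digits hq ha).tsum_le_tsum (fun i => ?_) hgeo.summable).trans
      hgeo.tsum_eq.le
    have : (a i : ℝ) ≤ M := by exact_mod_cast ha i
    rw [one_div_pow, div_mul_div_comm, mul_one, pow_succ']
    gcongr
  obtain ⟨q, hq, hqv⟩ := intermediate_value_Icc' (by linarith) hcont ⟨hhigh, hlow⟩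
  exact ⟨q, by linarith [hq.1], hq.2, hqv⟩

theorem baseOf_spec {M : ℕ} {a : ℕ → ℕ} (h : ∃ q : ℝ, 1 < q ∧ q ≤ M + 1 ∧ qg M q = a) :
    1 < baseOf M a ∧ baseOf M a ≤ M + 1 ∧ qg M (baseOf M a) = a := by
  rw [baseOf, dif_pos h]
  exact h.choose_spec

theorem approxIdx_spec {M : ℕ} {q : ℝ}
    (hex : ∀ k, ∃ n > k, memV M (perSeq (wMinus (prefixWord (qg M q) n)))) (m : ℕ) :
    m ≤ approxIdx M q m ∧
      memV M (perSeq (wMinus (prefixWord (qg M q) (approxIdx M q m)))) := by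
  induction m with
  | zero =>
    refine ⟨Nat.zero_le _, ?_⟩
    obtain ⟨n, hn, hV⟩ := hex 0
    exact (Nat.sInf_mem (s := {n : ℕ | 1 ≤ n ∧
      memV M (perSeq (wMinus (prefixWord (qg M q) n)))}) ⟨n, hn, hV⟩).2
  | succ m ih =>
    obtain ⟨n, hn, hV⟩ := hex (approxIdx M q m)
    have h := Nat.sInf_mem (s := {n : ℕ | approxIdx M q m < n ∧
      memV M (perSeq (wMinus (prefixWord (qg M q) n)))}) ⟨n, hn, hV⟩
    exact ⟨ih.1.trans_lt h.1, h.2⟩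

theorem wordLT_replicate_zero {N : ℕ} {f : ℕ → ℕ}
    (h : wordLT (List.replicate N 0) ((List.range N).map f)) : ∃ i < N, 0 < f i := by
  obtain ⟨n, hn, -, hlt⟩ := h
  rw [List.length_replicate] at hn
  exact ⟨n, hn, by simpa [hn] using hlt⟩

theorem wordLT_replicate {M N : ℕ} {f : ℕ → ℕ}
    (h : wordLT ((List.range N).map f) (List.replicate N M)) : ∃ i < N, f i < M := by
  obtain ⟨n, hn, -, hlt⟩ := h
  rw [List.length_map, List.length_range] at hn
  exact ⟨n, hn, by simpa [hn] using hlt⟩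

/-- For every `N ≥ 2`, `I_N ⊆ SI`. -/
theorem IN_subset_SI (M : ℕ) (hM : 1 ≤ M) (N : ℕ) (hN : 2 ≤ N) (q : ℝ)
    (hq : memIN M N q) : memSI M q := by
  obtain ⟨hVL, hpw, hbl⟩ := hq
  have hpre : ∀ i < 2 * N - 1, qg M q i = M := by
    intro i hi
    rw [← prefixWord_getD (qg M q) (show i < 2 * N by omega), hpw,
      List.getD_append _ _ _ _ (by simpa using hi)]
    simp [hi]
  have h0 : qg M q (2 * N - 1) = 0 := by
    rw [← prefixWord_getD (qg M q) (show 2 * N - 1 < 2 * N by omega), hpw,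
      List.getD_append_right _ _ _ _ (by simp)]
    simp
  have hblock : ∀ r : ℕ, 2 ≤ r →
      (∃ i < N, 0 < qg M q (r * N + i)) ∧ ∃ i < N, qg M q (r * N + i) < M := fun r hr =>
    ⟨wordLT_replicate_zero (hbl r hr).1, wordLT_replicate (hbl r hr).2⟩
  refine ⟨⟨hVL, irreducibleSeq_of_zero_runs hM hN hpre h0 ?_ ?_ fun j hj hz => ?_⟩,
    6 * N, fun m hm => ?_⟩
  · obtain ⟨i, hi, hx⟩ := (hblock 2 (by omega)).1
    exact ⟨2 * N + i, by omega, by omega, hx⟩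
  · obtain ⟨i, hi, hx⟩ := (hblock 3 (by omega)).1
    exact ⟨3 * N + i, by omega, by omega, hx⟩
  · obtain ⟨i, hi, hx⟩ := (exists_pos_and_exists_lt_of_blocks hN hblock hj).1
    have := hz i hi
    omega
  · have hex : ∀ k, ∃ n > k, memV M (perSeq (wMinus (prefixWord (qg M q) n))) := by
      intro k
      obtain ⟨i, hi, hx⟩ := (exists_pos_and_exists_lt_of_blocks hN hblock
        (j := 6 * N + k) (by omega)).1
      exact ⟨6 * N + k + i + 1, by omega,
        memV_perSeq hM hN (by omega) hVL.2.2.1 hpre h0 hblock (by simpa using hx)⟩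
    obtain ⟨hmn, hV⟩ := approxIdx_spec hex m
    rw [approxBase]
    set n := approxIdx M q m with hn
    have ha := perSeq_wMinus_prefixWord (qg M q) (n := n) (by omega)
    have hirr := irreducibleSeq_perSeq hM hN (n := n) (by omega) hpre h0 hblock
    set a := perSeq (wMinus (prefixWord (qg M q) n)) with hadef
    have ha0 : a 0 = M := by
      rw [ha, Nat.mod_eq_of_lt (by omega), if_neg (by omega), hpre 0 (by omega)]
    have ha1 : a 1 = M := by
      rw [ha, Nat.mod_eq_of_lt (by omega), if_neg (by omega), hpre 1 (by omega)]
    have hinf : ∀ k, ∃ l ≥ k, a l ≠ 0 := by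
      intro k
      refine ⟨n * k, Nat.le_mul_of_pos_left k (by omega), ?_⟩
      rw [ha, Nat.mul_mod_right, if_neg (by omega), hpre 0 (by omega)]
      omega
    obtain ⟨q', hq1, hq2, hqs⟩ := exists_base_tsum_eq_one hM hV.1 ha0 ha1
    have hqg : qg M q' = a := qg_eq_of_isQuasiGreedy
      (isQuasiGreedy_of_shift_le hq1 hV.1 hinf (fun n => (hV.2 n).2) hqs)
    obtain ⟨hb1, hb2, hb3⟩ := baseOf_spec ⟨q', hq1, hq2, hqg⟩
    exact ⟨⟨hb1, hb2, hb3.symm ▸ hV⟩, hb3.symm ▸ hirr⟩
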